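/- arXiv:1611.06438 — 4 statements merged into one kernel-verified Lean document; each statement's English description precedes it below -/
import Mathlib

section
/- Let X be a uniform space and D ⊆ X a dense subset. Then: (i) there is a monotone cofinal map from 𝒰_X^ℕ × ℕ^D (where ℕ^D is the set of functions D → ℕ ordered pointwise) to ℰ(C_u(X)); (ii) there is a monotone cofinal map from 𝒰_X^ℕ × C_u(X) to ℰ(C_u(X)); (iii) there is a monotone cofinal map from ℰ(C_u(X)) to 𝒰_X^ℕ × C_u(X). -/
open scoped Uniformity Topology

/-- `E` is a pointwise bounded, uniformly equicontinuous family of uniformly continuous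
real-valued functions on the uniform space `X`. -/
def IsPBEquicontinuous (X : Type*) [UniformSpace X] (E : Set (X → ℝ)) : Prop :=
  (∀ f ∈ E, UniformContinuous f) ∧
  (∀ x : X, ∃ M : ℝ, ∀ f ∈ E, |f x| ≤ M) ∧
  (∀ ε : ℝ, 0 < ε → ∃ U ∈ 𝓤 X, ∀ f ∈ E, ∀ p ∈ U, |f (Prod.fst p) - f (Prod.snd p)| < ε)

open Filter Set

section UniformSpace

variable {X ι : Type*} [u : UniformSpace X]

/-- Every entourage belongs to the uniformity of some uniformly continuous pseudometric. -/
theorem exists_pseudoMetricSpace_of_mem_uniformity {U : Set (X × X)} (hU : U ∈ 𝓤 X) :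
    ∃ m : PseudoMetricSpace X, 𝓤[u] ≤ 𝓤[m.toUniformSpace] ∧ U ∈ 𝓤[m.toUniformSpace] := by
  choose! s hs hsymm hcomp using
    fun (V : SetRel X X) (hV : V ∈ 𝓤 X) => comp_symm_mem_uniformity_sets hV
  have hsU : s U ⊆ U := by
    have h := hcomp U hU
    exact (subset_comp_self_of_mem_uniformity (hs U hU)).trans h
  let V : ℕ → SetRel X X := fun n => s^[n] (s U)
  have hV_succ (n : ℕ) : V (n + 1) = s (V n) := Function.iterate_succ_apply' s n (s U)
  have hV (n : ℕ) : V n ∈ 𝓤 X := by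
    induction n with
    | zero => exact hs U hU
    | succ n ih => rw [hV_succ]; exact hs _ ih
  have hV_symm (n : ℕ) : (V n).IsSymm := by
    cases n with
    | zero => exact hsymm U hU
    | succ n => rw [hV_succ]; exact hsymm _ (hV n)
  have hV_anti : Antitone V := antitone_nat_of_succ_le fun n => by
    have h := hcomp _ (hV n)
    rw [← hV_succ] at h
    exact (subset_comp_self_of_mem_uniformity (hV (n + 1))).trans h
  have hB : (⨅ n, 𝓟 (V n)).HasAntitoneBasis V := .iInf_principal hV_anti
  let c : UniformSpace.Core X := .mk' (⨅ n, 𝓟 (V n))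
    (fun r hr x => by
      obtain ⟨n, hn⟩ := hB.mem_iff.1 hr
      exact hn (refl_mem_uniformity (hV n)))
    (fun r hr => by
      obtain ⟨n, -, hn⟩ := hB.toHasBasis.mem_iff.1 hr
      exact mem_of_superset (hB.mem n) fun p hp => hn ((hV_symm n).symm _ _ hp))
    (fun r hr => by
      obtain ⟨n, -, hn⟩ := hB.toHasBasis.mem_iff.1 hr
      refine ⟨V (n + 1), hB.mem _, ?_⟩
      rw [hV_succ]
      exact (hcomp _ (hV n)).trans hn)
  let v : UniformSpace X := .ofCore c
  have hv : 𝓤[v] = ⨅ n, 𝓟 (V n) := rfl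
  have : IsCountablyGenerated 𝓤[v] := hB.isCountablyGenerated
  obtain ⟨m, hm⟩ := @UniformSpace.metrizable_uniformity X v this
  refine ⟨m, ?_, ?_⟩
  · rw [hm, hv]
    exact le_iInf fun n => le_principal_iff.2 (hV n)
  · rw [hm, hv]
    exact mem_of_superset (hB.mem 0) hsU

/-- Every entourage is detected by a uniformly equicontinuous family of `[0, 1]`-valued
functions. -/
theorem exists_uniformEquicontinuous_separating {U : Set (X × X)} (hU : U ∈ 𝓤 X) :
    ∃ δ : X → X → ℝ, (∀ x, δ x x = 0) ∧ (∀ x y, δ x y ∈ Icc 0 1) ∧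
      UniformEquicontinuous δ ∧ ∀ x y, δ x y < 1 → (x, y) ∈ U := by
  obtain ⟨m, hm, hUm⟩ := exists_pseudoMetricSpace_of_mem_uniformity hU
  obtain ⟨r, hr, hrU⟩ := (@Metric.mem_uniformity_dist X m U).1 hUm
  refine ⟨fun x y => min 1 (m.dist x y / r), fun x => ?_, fun x y => ⟨?_, min_le_left _ _⟩,
    ?_, fun x y h => ?_⟩
  · simp
  · exact le_min zero_le_one (div_nonneg (@dist_nonneg X m x y) hr.le)
  · refine Metric.uniformEquicontinuous_iff_right.2 fun ε hε => ?_
    have hW : {p : X × X | m.dist p.1 p.2 < ε * r} ∈ 𝓤[u] :=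
      hm (@Metric.dist_mem_uniformity X m _ (mul_pos hε hr))
    filter_upwards [hW] with p hp a
    rw [Real.dist_eq]
    refine (abs_min_sub_min_le_max _ _ _ _).trans_lt ?_
    rw [sub_self, abs_zero, max_lt_iff]
    refine ⟨hε, ?_⟩
    rw [← sub_div, abs_div, abs_of_pos hr, div_lt_iff₀ hr]
    refine lt_of_le_of_lt ?_ hp
    have := @abs_dist_sub_le X m p.1 p.2 a
    rwa [@dist_comm X m p.1 a, @dist_comm X m p.2 a] at this
  · refine hrU ?_
    rw [min_lt_iff] at h
    exact (div_lt_one hr).1 (h.resolve_left (lt_irrefl 1))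

/-- The uniformly continuous functions with modulus of continuity prescribed by the sets `U n` and
bounded by `φ` along `e`. -/
def boundedModulusSet (U : ℕ → Set (X × X)) (e : ι → X) (φ : ι → ℝ) : Set (X → ℝ) :=
  {f | UniformContinuous f ∧ (∀ n : ℕ, ∀ p ∈ U n, |f p.1 - f p.2| ≤ 1 / ((n : ℝ) + 1)) ∧
    ∀ i, |f (e i)| ≤ φ i}

theorem boundedModulusSet_mono {U V : ℕ → Set (X × X)} {e : ι → X} {φ ψ : ι → ℝ}
    (hUV : ∀ n, V n ⊆ U n) (h : ∀ i, φ i ≤ ψ i) :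
    boundedModulusSet U e φ ⊆ boundedModulusSet V e ψ := fun _ hf =>
  ⟨hf.1, fun n p hp => hf.2.1 n p (hUV n hp), fun i => (hf.2.2 i).trans (h i)⟩

theorem isPBEquicontinuous_boundedModulusSet {U : ℕ → Set (X × X)} (hU : ∀ n, U n ∈ 𝓤 X)
    {e : ι → X} (he : DenseRange e) (φ : ι → ℝ) :
    IsPBEquicontinuous X (boundedModulusSet U e φ) := by
  refine ⟨fun f hf => hf.1, fun x => ?_, fun ε hε => ?_⟩
  · obtain ⟨i, hi⟩ := he.exists_mem_open isOpen_interior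
      ⟨x, mem_interior_iff_mem_nhds.2 (mem_nhds_left x (hU 0))⟩
    refine ⟨1 + φ i, fun f hf => ?_⟩
    have h₁ := hf.2.1 0 (x, e i) (interior_subset (s := {y | (x, y) ∈ U 0}) hi)
    have h₂ := hf.2.2 i
    have h₃ := abs_sub_abs_le_abs_sub (f x) (f (e i))
    norm_num at h₁
    linarith
  · obtain ⟨n, hn⟩ := exists_nat_one_div_lt hε
    exact ⟨U n, hU n, fun f hf p hp => (hf.2.1 n p hp).trans_lt hn⟩

end UniformSpace

namespace IsPBEquicontinuous

variable {X : Type*} [UniformSpace X] {E F : Set (X → ℝ)}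

theorem setOf_forall_abs_sub_lt_mem_uniformity (hE : IsPBEquicontinuous X E) {ε : ℝ}
    (hε : 0 < ε) : {p : X × X | ∀ f ∈ E, |f p.1 - f p.2| < ε} ∈ 𝓤 X := by
  obtain ⟨U, hU, h⟩ := hE.2.2 ε hε
  exact mem_of_superset hU fun p hp f hf => h f hf p hp

theorem bddAbove_range_abs (hE : IsPBEquicontinuous X E) (x : X) :
    BddAbove (range fun f : E => |f.1 x|) := by
  obtain ⟨M, hM⟩ := hE.2.1 x
  exact ⟨M, forall_mem_range.2 fun f => hM f.1 f.2⟩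

theorem abs_le_iSup (hE : IsPBEquicontinuous X E) {f : X → ℝ} (hf : f ∈ E) (x : X) :
    |f x| ≤ ⨆ f : E, |f.1 x| :=
  le_ciSup (hE.bddAbove_range_abs x) ⟨f, hf⟩

theorem iSup_abs_mono (hF : IsPBEquicontinuous X F) (h : E ⊆ F) (x : X) :
    ⨆ f : E, |f.1 x| ≤ ⨆ f : F, |f.1 x| :=
  Real.iSup_le (fun f => hF.abs_le_iSup (h f.2) x) (Real.iSup_nonneg fun _ => abs_nonneg _)

theorem uniformContinuous_iSup_abs (hE : IsPBEquicontinuous X E) :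
    UniformContinuous fun x => ⨆ f : E, |f.1 x| := by
  have key {ε : ℝ} (hε : 0 < ε) {x y : X} (h : ∀ f ∈ E, |f x - f y| < ε) :
      ⨆ f : E, |f.1 x| ≤ (⨆ f : E, |f.1 y|) + ε := by
    refine Real.iSup_le (fun f => ?_)
      (add_nonneg (Real.iSup_nonneg fun _ => abs_nonneg _) hε.le)
    have h₁ := h f.1 f.2
    have h₂ := hE.abs_le_iSup f.2 y
    have h₃ := abs_sub_abs_le_abs_sub (f.1 x) (f.1 y)
    linarith
  refine Metric.uniformity_basis_dist_le.tendsto_right_iff.2 fun ε hε => ?_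
  filter_upwards [(hE.setOf_forall_abs_sub_lt_mem_uniformity hε)] with p hp
  have h₁ := key hε hp
  have h₂ := key hε fun f hf => (abs_sub_comm _ _).trans_lt (hp f hf)
  exact abs_sub_le_iff.2 ⟨by linarith, by linarith⟩

theorem exists_subset_modulus (hE : IsPBEquicontinuous X E) :
    ∃ U : ℕ → {U : Set (X × X) // U ∈ 𝓤 X},
      ∀ f ∈ E, ∀ n : ℕ, ∀ p ∈ (U n).1, |f p.1 - f p.2| ≤ 1 / ((n : ℝ) + 1) := by
  choose U hU h using fun n : ℕ => hE.2.2 (1 / ((n : ℝ) + 1)) Nat.one_div_pos_of_nat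
  exact ⟨fun n => ⟨U n, hU n⟩, fun f hf n p hp => (h n f hf p hp).le⟩

protected theorem insert (hE : IsPBEquicontinuous X E) {g : X → ℝ} (hg : UniformContinuous g) :
    IsPBEquicontinuous X (insert g E) := by
  refine ⟨forall_mem_insert.2 ⟨hg, hE.1⟩, fun x => ?_, fun ε hε => ?_⟩
  · obtain ⟨M, hM⟩ := hE.2.1 x
    exact ⟨max |g x| M, forall_mem_insert.2
      ⟨le_max_left _ _, fun f hf => (hM f hf).trans (le_max_right _ _)⟩⟩
  · obtain ⟨U, hU, h⟩ := hE.2.2 ε hε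
    refine ⟨U ∩ {p | dist (g p.1) (g p.2) < ε}, inter_mem hU (hg (Metric.dist_mem_uniformity hε)),
      forall_mem_insert.2 ⟨fun p hp => hp.2, fun f hf p hp => h f hf p hp.1⟩⟩

/-- Rescaling countably many uniformly equicontinuous families of `[0, 1]`-valued functions by a
null sequence yields a single uniformly equicontinuous family. -/
theorem range_one_div_mul {ι : Type*} {δ : ℕ → ι → X → ℝ}
    (h01 : ∀ n i x, δ n i x ∈ Icc 0 1) (hδ : ∀ n, UniformEquicontinuous (δ n)) :
    IsPBEquicontinuous X
      (range fun (q : ℕ × ι) x => 1 / ((q.1 : ℝ) + 1) * δ q.1 q.2 x) := by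
  have hpos (n : ℕ) : 0 < 1 / ((n : ℝ) + 1) := Nat.one_div_pos_of_nat
  have hle (n : ℕ) : 1 / ((n : ℝ) + 1) ≤ 1 := by
    simpa using Nat.one_div_le_one_div (α := ℝ) (Nat.zero_le n)
  have habs (n : ℕ) (i : ι) (x y : X) : |δ n i x - δ n i y| ≤ 1 := by
    have hx := h01 n i x
    have hy := h01 n i y
    exact abs_sub_le_iff.2 ⟨by linarith [hx.2, hy.1], by linarith [hx.1, hy.2]⟩
  refine ⟨forall_mem_range.2 fun q => ?_, fun x => ⟨1, forall_mem_range.2 fun q => ?_⟩,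
    fun ε hε => ?_⟩
  · exact ((hδ q.1).uniformContinuous q.2).const_mul' _
  · have hx := h01 q.1 q.2 x
    rw [abs_of_nonneg (mul_nonneg (hpos _).le hx.1)]
    exact mul_le_one₀ (hle _) hx.1 hx.2
  · obtain ⟨N, hN⟩ := exists_nat_one_div_lt hε
    refine ⟨⋂ n ∈ Iio N, {p | ∀ i, dist (δ n i p.1) (δ n i p.2) < ε},
      (biInter_mem (finite_Iio N)).2 fun n _ =>
        Metric.uniformEquicontinuous_iff_right.1 (hδ n) ε hε, forall_mem_range.2 fun q p hp => ?_⟩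
    rw [← mul_sub, abs_mul, abs_of_pos (hpos _)]
    rcases lt_or_ge q.1 N with hq | hq
    · refine (mul_le_of_le_one_left (abs_nonneg _) (hle _)).trans_lt ?_
      exact mem_iInter₂.1 hp q.1 hq q.2
    · refine (mul_le_of_le_one_right (hpos _).le (habs _ _ _ _)).trans_lt ?_
      exact (Nat.one_div_le_one_div hq).trans_lt hN

end IsPBEquicontinuous

/-- There exist monotone cofinal maps (i) `𝒰_X^ℕ × ℕ^D → ℰ(C_u(X))`,
(ii) `𝒰_X^ℕ × C_u(X) → ℰ(C_u(X))` and (iii) `ℰ(C_u(X)) → 𝒰_X^ℕ × C_u(X)`,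
where `𝒰_X` is ordered by reverse inclusion, `ℕ^D` and `C_u(X)` pointwise,
and `ℰ(C_u(X))` by inclusion. -/
theorem statement3 {X : Type*} [UniformSpace X] (D : Set X) (hD : Dense D) :
    (∃ Φ : (ℕ → {U : Set (X × X) // U ∈ 𝓤 X}) × (↥D → ℕ) →
        {E : Set (X → ℝ) // IsPBEquicontinuous X E},
      (∀ p q : (ℕ → {U : Set (X × X) // U ∈ 𝓤 X}) × (↥D → ℕ),
        (∀ n, (q.1 n).1 ⊆ (p.1 n).1) → (∀ d, p.2 d ≤ q.2 d) → (Φ p).1 ⊆ (Φ q).1) ∧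
      (∀ E : {E : Set (X → ℝ) // IsPBEquicontinuous X E}, ∃ p, E.1 ⊆ (Φ p).1)) ∧
    (∃ Ψ : (ℕ → {U : Set (X × X) // U ∈ 𝓤 X}) × {f : X → ℝ // UniformContinuous f} →
        {E : Set (X → ℝ) // IsPBEquicontinuous X E},
      (∀ p q : (ℕ → {U : Set (X × X) // U ∈ 𝓤 X}) × {f : X → ℝ // UniformContinuous f},
        (∀ n, (q.1 n).1 ⊆ (p.1 n).1) → (∀ x, (p.2).1 x ≤ (q.2).1 x) → (Ψ p).1 ⊆ (Ψ q).1) ∧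
      (∀ E : {E : Set (X → ℝ) // IsPBEquicontinuous X E}, ∃ p, E.1 ⊆ (Ψ p).1)) ∧
    (∃ Θ : {E : Set (X → ℝ) // IsPBEquicontinuous X E} →
        (ℕ → {U : Set (X × X) // U ∈ 𝓤 X}) × {f : X → ℝ // UniformContinuous f},
      (∀ E F : {E : Set (X → ℝ) // IsPBEquicontinuous X E}, E.1 ⊆ F.1 →
        (∀ n, ((Θ F).1 n).1 ⊆ ((Θ E).1 n).1) ∧ (∀ x, ((Θ E).2).1 x ≤ ((Θ F).2).1 x)) ∧
      (∀ p : (ℕ → {U : Set (X × X) // U ∈ 𝓤 X}) × {f : X → ℝ // UniformContinuous f},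
        ∃ E, (∀ n, ((Θ E).1 n).1 ⊆ (p.1 n).1) ∧ (∀ x, (p.2).1 x ≤ ((Θ E).2).1 x))) := by
  refine ⟨⟨fun p => ⟨_, isPBEquicontinuous_boundedModulusSet (fun n => (p.1 n).2)
      hD.denseRange_val fun d => (p.2 d : ℝ)⟩, fun p q hU hφ => ?_, fun E => ?_⟩,
    ⟨fun p => ⟨_, isPBEquicontinuous_boundedModulusSet (fun n => (p.1 n).2)
      denseRange_id p.2.1⟩, fun p q hU hφ => ?_, fun E => ?_⟩,
    ⟨fun E => (fun n => ⟨_, E.2.setOf_forall_abs_sub_lt_mem_uniformity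
      (Nat.one_div_pos_of_nat (n := n))⟩, ⟨_, E.2.uniformContinuous_iSup_abs⟩),
      fun E F h => ?_, fun p => ?_⟩⟩
  · exact boundedModulusSet_mono hU fun d => Nat.cast_le.2 (hφ d)
  · obtain ⟨U, hU⟩ := E.2.exists_subset_modulus
    choose M hM using E.2.2.1
    exact ⟨(U, fun d => ⌈M d⌉₊), fun f hf =>
      ⟨E.2.1 f hf, hU f hf, fun d => (hM d f hf).trans (Nat.le_ceil _)⟩⟩
  · exact boundedModulusSet_mono hU hφ
  · obtain ⟨U, hU⟩ := E.2.exists_subset_modulus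
    exact ⟨(U, ⟨_, E.2.uniformContinuous_iSup_abs⟩), fun f hf =>
      ⟨E.2.1 f hf, hU f hf, fun x => E.2.abs_le_iSup hf x⟩⟩
  · exact ⟨fun n q hq f hf => hq f (h hf), fun x => F.2.iSup_abs_mono h x⟩
  · choose δ hδ0 hδ01 hδ hδU using
      fun n => exists_uniformEquicontinuous_separating (p.1 n).2
    have hE := (IsPBEquicontinuous.range_one_div_mul hδ01 hδ).insert p.2.2
    refine ⟨⟨_, hE⟩, fun n q hq => hδU n q.1 q.2 ?_,
      fun x => (le_abs_self _).trans (hE.abs_le_iSup (mem_insert _ _) x)⟩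
    have h := hq _ (mem_insert_of_mem _ (mem_range_self (n, q.1)))
    have hpos : 0 < 1 / ((n : ℝ) + 1) := Nat.one_div_pos_of_nat
    simp only [hδ0, mul_zero, zero_sub, abs_neg] at h
    rw [abs_of_nonneg (mul_nonneg hpos.le (hδ01 n _ _).1)] at h
    exact lt_of_mul_lt_mul_left (h.trans_eq (mul_one _).symm) hpos.le
end

section
/- For every locally ω-bounded function φ : X → ℝ on a uniform space X there exists an ω-continuous function ψ : X → ℝ such that φ(x) ≤ ψ(x) for all x ∈ X. -/
open scoped Uniformity Topology

/-- A function `f : X → ℝ` on a uniform space is locally `ω`-bounded if there is a countable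
family of entourages such that every point `x` has some member `V` of the family with `f`
bounded above on the ball `V[x]`. -/
def LocallyOmegaBounded {X : Type*} [UniformSpace X] (f : X → ℝ) : Prop :=
  ∃ V : ℕ → Set (X × X), (∀ n, V n ∈ 𝓤 X) ∧
    ∀ x : X, ∃ n, ∃ M : ℝ, ∀ y : X, (x, y) ∈ V n → f y ≤ M

/-- A function `f : X → ℝ` on a uniform space is `ω`-continuous if for every `ε > 0` there is a
countable family of entourages such that every point `x` has some member `V` of the family with
`f (V[x]) ⊆ (f x - ε, f x + ε)`. -/
def OmegaContinuousR {X : Type*} [UniformSpace X] (f : X → ℝ) : Prop :=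
  ∀ ε : ℝ, 0 < ε → ∃ V : ℕ → Set (X × X), (∀ n, V n ∈ 𝓤 X) ∧
    ∀ x : X, ∃ n, ∀ y : X, (x, y) ∈ V n → f y ∈ Set.Ioo (f x - ε) (f x + ε)

/-- Any sequence of entourages of a uniform space lies in a coarser uniformity that is
countably generated. -/
theorem exists_coarser_isCountablyGenerated_uniformity {X : Type*} [u₀ : UniformSpace X]
    (V : ℕ → Set (X × X)) (hV : ∀ n, V n ∈ 𝓤 X) :
    ∃ u : UniformSpace X, u₀ ≤ u ∧ (𝓤[u]).IsCountablyGenerated ∧ ∀ n, V n ∈ 𝓤[u] := by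
  choose half half_mem half_symm half_comp using
    fun s : {s : Set (X × X) // s ∈ 𝓤 X} => comp_symm_of_uniformity s.2
  let U : ℕ → {s : Set (X × X) // s ∈ 𝓤 X} := fun n => Nat.rec ⟨Set.univ, Filter.univ_mem⟩
    (fun k s => ⟨half ⟨s.1 ∩ V k, Filter.inter_mem s.2 (hV k)⟩, half_mem _⟩) n
  have comp_subset (n : ℕ) : SetRel.comp (U (n + 1)).1 (U (n + 1)).1 ⊆ (U n).1 ∩ V n :=
    half_comp ⟨(U n).1 ∩ V n, Filter.inter_mem (U n).2 (hV n)⟩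
  have succ_subset (n : ℕ) : (U (n + 1)).1 ⊆ (U n).1 ∩ V n := fun p hp =>
    comp_subset n (SetRel.prodMk_mem_comp (refl_mem_uniformity (U (n + 1)).2) hp)
  have anti : Antitone fun n => (U n).1 :=
    antitone_nat_of_succ_le fun n => (succ_subset n).trans Set.inter_subset_left
  have symm : ∀ n, (U n).1 ⊆ Prod.swap ⁻¹' (U n).1 := by
    rintro (_ | n) ⟨a, b⟩ hp
    · trivial
    · exact half_symm _ hp
  let B : FilterBasis (X × X) :=
    { sets := Set.range fun n => (U n).1
      nonempty := Set.range_nonempty _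
      inter_sets := by
        rintro _ _ ⟨m, rfl⟩ ⟨n, rfl⟩
        exact ⟨_, ⟨max m n, rfl⟩,
          Set.subset_inter (anti (le_max_left m n)) (anti (le_max_right m n))⟩ }
  have mem_B (n : ℕ) : (U n).1 ∈ B := ⟨n, rfl⟩
  let c : UniformSpace.Core X := .mkOfBasis B
    (by rintro _ ⟨n, rfl⟩ x; exact refl_mem_uniformity (U n).2)
    (by rintro _ ⟨n, rfl⟩; exact ⟨_, mem_B n, symm n⟩)
    (by
      rintro _ ⟨n, rfl⟩
      exact ⟨_, mem_B (n + 1), (comp_subset n).trans Set.inter_subset_left⟩)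
  refine ⟨.ofCore c, ?_, ?_, fun n => ?_⟩
  · refine UniformSpace.le_def.2 (B.hasBasis.ge_iff.2 ?_)
    rintro _ ⟨n, rfl⟩
    exact (U n).2
  · exact ⟨B.sets, Set.countable_range _, B.generate.symm⟩
  · exact B.hasBasis.mem_iff.2 ⟨_, mem_B (n + 1), (succ_subset n).trans Set.inter_subset_right⟩

/-- A function that is continuous for a coarser countably generated uniformity is
`ω`-continuous. -/
theorem OmegaContinuousR.of_continuous {X : Type*} {u u₀ : UniformSpace X}
    (hu : u₀ ≤ u) [(𝓤[u]).IsCountablyGenerated] {f : X → ℝ}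
    (hf : @Continuous X ℝ u.toTopologicalSpace _ f) : OmegaContinuousR f := by
  intro ε hε
  obtain ⟨W, hW⟩ := (𝓤[u]).exists_antitone_basis
  refine ⟨W, fun n => hu (hW.mem n), fun x => ?_⟩
  have hx : f ⁻¹' Set.Ioo (f x - ε) (f x + ε) ∈ @nhds X u.toTopologicalSpace x :=
    Filter.Tendsto.eventually_mem (@Continuous.continuousAt X ℝ u.toTopologicalSpace _ f x hf)
      (Ioo_mem_nhds (by linarith) (by linarith))
  obtain ⟨n, -, hn⟩ := (@nhds_basis_uniformity' _ _ u _ _ hW.1 x).mem_iff.1 hx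
  exact ⟨n, fun y hy => hn hy⟩

/-- On a space with countably generated uniformity, a function that is bounded above near every
point is dominated by a continuous function. -/
theorem exists_continuous_ge_of_locally_bddAbove {X : Type*} [UniformSpace X]
    [(𝓤 X).IsCountablyGenerated] (φ : X → ℝ) (hφ : ∀ x, ∃ M, ∀ᶠ y in 𝓝 x, φ y ≤ M) :
    ∃ ψ : X → ℝ, Continuous ψ ∧ ∀ x, φ x ≤ ψ x := by
  let := UniformSpace.pseudoMetricSpace X
  obtain ⟨g, hg⟩ := exists_continuous_forall_mem_convex_of_local_const
    (t := fun x => Set.Ici (φ x)) (fun x => convex_Ici _) hφ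
  exact ⟨g, g.continuous, hg⟩

theorem statement4 {X : Type*} [UniformSpace X] (φ : X → ℝ)
    (h : LocallyOmegaBounded φ) :
    ∃ ψ : X → ℝ, OmegaContinuousR ψ ∧ ∀ x, φ x ≤ ψ x := by
  obtain ⟨V, hV, hφ⟩ := h
  obtain ⟨u, hu, hc, hVu⟩ := exists_coarser_isCountablyGenerated_uniformity V hV
  obtain ⟨ψ, hψ, hle⟩ := @exists_continuous_ge_of_locally_bddAbove X u hc φ fun x => by
    obtain ⟨n, M, hM⟩ := hφ x
    exact ⟨M, Filter.mem_of_superset (@mem_nhds_left X u x _ (hVu n)) hM⟩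
  exact ⟨ψ, .of_continuous hu hψ, hle⟩
end

section
/- If a uniform space X is σ-bounded, then the set C_u(X) of uniformly continuous real-valued functions on X is ω^ω-dominated in ℝ^X. -/
open scoped Uniformity Topology

/-- A subset `B` of a uniform space is functionally bounded if every uniformly continuous
real-valued function is bounded on `B`. -/
def FunctionallyBounded {X : Type*} [UniformSpace X] (B : Set X) : Prop :=
  ∀ f : X → ℝ, UniformContinuous f → ∃ M : ℝ, ∀ x ∈ B, |f x| ≤ M

/-- A uniform space is `σ`-bounded if it is a countable union of functionally bounded sets. -/
def SigmaBounded (X : Type*) [UniformSpace X] : Prop :=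
  ∃ B : ℕ → Set X, (⋃ n, B n) = Set.univ ∧ ∀ n, FunctionallyBounded (B n)

/-- If a uniform space `X` is `σ`-bounded, then the set `C_u(X)` of uniformly continuous
real-valued functions on `X` is `ω^ω`-dominated in `ℝ^X`. -/
theorem statement5 {X : Type*} [UniformSpace X] (h : SigmaBounded X) :
    ∃ F : (ℕ → ℕ) → (X → ℝ),
      (∀ α β : ℕ → ℕ, α ≤ β → ∀ x, F α x ≤ F β x) ∧
      (∀ f : X → ℝ, UniformContinuous f → ∃ α, ∀ x, f x ≤ F α x) := by
  obtain ⟨B, hcover, hB⟩ := h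
  have hmem : ∀ x, ∃ n, x ∈ B n := fun x => Set.mem_iUnion.mp (hcover ▸ Set.mem_univ x)
  choose index hindex using hmem
  refine ⟨fun α x => (α (index x) : ℝ), fun α β hαβ x => Nat.cast_le.mpr (hαβ (index x)), ?_⟩
  intro f hf
  choose M hM using fun n => hB n f hf
  refine ⟨fun n => ⌈M n⌉₊, fun x => ?_⟩
  calc f x ≤ |f x| := le_abs_self _
    _ ≤ M (index x) := hM _ x (hindex x)
    _ ≤ ⌈M (index x)⌉₊ := Nat.le_ceil _
end

section
/- Let f : X → Y be a uniformly quotient map between uniform spaces. If the uniformity of X has an ω^ω-base, then the uniformity of Y has an ω^ω-base. -/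
open scoped Uniformity Topology

/-- A uniform space has an `ω^ω`-base. -/
def UniformOmegaBase (X : Type*) [UniformSpace X] : Prop :=
  ∃ U : (ℕ → ℕ) → Set (X × X),
    (∀ α, U α ∈ 𝓤 X) ∧
    (∀ α β : ℕ → ℕ, α ≤ β → U β ⊆ U α) ∧
    (∀ V ∈ 𝓤 X, ∃ α, U α ⊆ V)

/-- If `f : X → Y` is a uniformly quotient map between uniform spaces and the uniformity of
`X` has an `ω^ω`-base, then the uniformity of `Y` has an `ω^ω`-base. -/
theorem statement15 {X Y : Type*} [UniformSpace X] [UniformSpace Y] (f : X → Y)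
    (hsurj : Function.Surjective f)
    (hquot : ∀ U : Set (Y × Y), U ∈ 𝓤 Y ↔ {p : X × X | (f p.1, f p.2) ∈ U} ∈ 𝓤 X)
    (hX : UniformOmegaBase X) :
    UniformOmegaBase Y := by
  obtain ⟨U, hU, hmono, hbase⟩ := hX
  refine ⟨fun α => Prod.map f f '' U α, fun α => ?_, fun α β h => ?_, fun V hV => ?_⟩
  · exact (hquot _).2 (Filter.mem_of_superset (hU α) fun p hp => ⟨p, hp, rfl⟩)
  · exact Set.image_mono (hmono α β h)
  · obtain ⟨α, hα⟩ := hbase _ ((hquot V).1 hV)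
    exact ⟨α, Set.image_subset_iff.2 hα⟩
end
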